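/- Consider a sequence of experiments indexed by k ∈ ℕ with nₖ, Tₖ, Pₖ positive integers, compact 𝒳 ⊂ ℝ^d, s ≥ 0 an integer, f: 𝒳 → ℝ and basis functions ψ_{j,Pₖ}: 𝒳 → ℝ all s-times continuously differentiable, design points X₁,…,X_{Tₖ} ∈ 𝒳 forming the Tₖ×Pₖ matrix Ψₖ, and for each k independent-in-expectation errors ε₁,…,ε_{nₖ} in ℝ^{Tₖ} (mean zero, covariances Σᵢ, uncorrelated across i), with Σ̄ₖ the average covariance, λₖ := λ_max(Σ̄ₖ), τₖ := tr(Σ̄ₖ), f̂_{Pₖ} the least-squares sieve estimator, N_{Pₖ} := |f − f_{Pₖ,0}|_s the approximation error, and ζ_s(Pₖ) the sup of Euclidean norms of derivatives of the basis vector up to order s. Assume λ_min(Ψₖ'Ψₖ/Tₖ) ≥ 1/2 for all k, that ζ_s(Pₖ)·( min(Pₖλₖ, τₖ)/(nₖTₖ) )^{1/2} → 0, and that ζ_s(Pₖ)·N_{Pₖ} → 0 as k → ∞. Then |f̂_{Pₖ} − f|_s converges to 0 in probability; moreover, for every ε > 0 there exists C > 0 such that for all k, P( |f̂_{Pₖ}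 − f|_s > C·( ζ_s(Pₖ)(min(Pₖλₖ, τₖ)/(nₖTₖ))^{1/2} + (ζ_s(Pₖ)+1)N_{Pₖ} ) ) ≤ ε. -/

import Mathlib

open MeasureTheory Matrix Filter
open scoped BigOperators

/-- Smallest eigenvalue of a symmetric matrix, via the Rayleigh quotient
(Courant–Fischer characterization). -/
noncomputable def eigMin {m : Type*} [Fintype m] (M : Matrix m m ℝ) : ℝ :=
  sInf {r : ℝ | ∃ x : m → ℝ, x ⬝ᵥ x = 1 ∧ r = x ⬝ᵥ M.mulVec x}

/-- Largest eigenvalue of a symmetric matrix, via the Rayleigh quotient. -/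
noncomputable def eigMax {m : Type*} [Fintype m] (M : Matrix m m ℝ) : ℝ :=
  sSup {r : ℝ | ∃ x : m → ℝ, x ⬝ᵥ x = 1 ∧ r = x ⬝ᵥ M.mulVec x}

/-- Partial derivative of `g : ℝ^d → ℝ` in the `k`-th coordinate direction. -/
noncomputable def pderiv1 {d : ℕ} (k : Fin d) (g : (Fin d → ℝ) → ℝ) :
    (Fin d → ℝ) → ℝ :=
  fun x => fderiv ℝ g x (Pi.single k 1)

/-- Multi-index partial derivative `∂^ℓ g`. -/
noncomputable def mpderiv {d : ℕ} (ℓ : Fin d → ℕ) (g : (Fin d → ℝ) → ℝ) :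
    (Fin d → ℝ) → ℝ :=
  (List.finRange d).foldr (fun k h => (pderiv1 k)^[ℓ k] h) g

/-- Sobolev sup-norm `|g|_s = max_{|ℓ| ≤ s} sup_{x ∈ X} |∂^ℓ g(x)|` on the set `X`. -/
noncomputable def sobNorm {d : ℕ} (s : ℕ) (X : Set (Fin d → ℝ))
    (g : (Fin d → ℝ) → ℝ) : ℝ :=
  ⨆ ℓ : {ℓ : Fin d → ℕ // ∑ k, ℓ k ≤ s}, ⨆ x : X, |mpderiv ℓ.1 g x|

/-- `ζ_s(P) = max_{|ℓ| ≤ s} sup_{x ∈ X} ‖∂^ℓ ψ_P(x)‖`. -/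
noncomputable def zetaS {d P : ℕ} (s : ℕ) (X : Set (Fin d → ℝ))
    (ψ : Fin P → (Fin d → ℝ) → ℝ) : ℝ :=
  ⨆ ℓ : {ℓ : Fin d → ℕ // ∑ k, ℓ k ≤ s}, ⨆ x : X,
    Real.sqrt (∑ j, (mpderiv ℓ.1 (ψ j) x) ^ 2)

section MultiIndexDerivatives

variable {d : ℕ}

lemma contDiff_pderiv1 (k : Fin d) {r : ℕ} {g : (Fin d → ℝ) → ℝ}
    (hg : ContDiff ℝ ((r + 1 : ℕ) : WithTop ℕ∞) g) :
    ContDiff ℝ (r : WithTop ℕ∞) (pderiv1 k g) := by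
  have h := hg.fderiv_right (m := (r : WithTop ℕ∞)) (by push_cast; exact le_rfl)
  exact h.clm_apply contDiff_const

lemma pderiv1_const_mul_add (k : Fin d) (a : ℝ) {g h : (Fin d → ℝ) → ℝ}
    (hg : Differentiable ℝ g) (hh : Differentiable ℝ h) :
    pderiv1 k (fun x => a * g x + h x) = fun x => a * pderiv1 k g x + pderiv1 k h x := by
  funext x
  unfold pderiv1
  rw [fderiv_fun_add ((hg x).const_mul a) (hh x), fderiv_const_mul (hg x)]
  simp

lemma contDiff_iterate_pderiv1 (k : Fin d) (m : ℕ) {r : ℕ} {g : (Fin d → ℝ) → ℝ}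
    (hg : ContDiff ℝ ((r + m : ℕ) : WithTop ℕ∞) g) :
    ContDiff ℝ (r : WithTop ℕ∞) ((pderiv1 k)^[m] g) := by
  induction m generalizing g with
  | zero => simpa using hg
  | succ m ih => exact ih (contDiff_pderiv1 k hg)

lemma iterate_pderiv1_const_mul_add (k : Fin d) (a : ℝ) (m : ℕ) {g h : (Fin d → ℝ) → ℝ}
    (hg : ContDiff ℝ (m : WithTop ℕ∞) g) (hh : ContDiff ℝ (m : WithTop ℕ∞) h) :
    (pderiv1 k)^[m] (fun x => a * g x + h x) =
      fun x => a * (pderiv1 k)^[m] g x + (pderiv1 k)^[m] h x := by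
  induction m generalizing g h with
  | zero => rfl
  | succ m ih =>
    have h0 : ((m + 1 : ℕ) : WithTop ℕ∞) ≠ 0 := by exact_mod_cast Nat.succ_ne_zero m
    simp only [Function.iterate_succ_apply]
    rw [pderiv1_const_mul_add k a (hg.differentiable h0) (hh.differentiable h0)]
    exact ih (contDiff_pderiv1 k hg) (contDiff_pderiv1 k hh)

lemma contDiff_foldr_pderiv1 (ℓ : Fin d → ℕ) (L : List (Fin d)) {r : ℕ}
    {g : (Fin d → ℝ) → ℝ} (hg : ContDiff ℝ ((r + (L.map ℓ).sum : ℕ) : WithTop ℕ∞) g) :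
    ContDiff ℝ (r : WithTop ℕ∞) (L.foldr (fun k h => (pderiv1 k)^[ℓ k] h) g) := by
  induction L generalizing r with
  | nil => simpa using hg
  | cons k L ih =>
    refine contDiff_iterate_pderiv1 k (ℓ k) (ih ?_)
    simpa [add_assoc] using hg

lemma foldr_pderiv1_const_mul_add (ℓ : Fin d → ℕ) (a : ℝ) (L : List (Fin d))
    {g h : (Fin d → ℝ) → ℝ} (hg : ContDiff ℝ (((L.map ℓ).sum : ℕ) : WithTop ℕ∞) g)
    (hh : ContDiff ℝ (((L.map ℓ).sum : ℕ) : WithTop ℕ∞) h) :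
    L.foldr (fun k h => (pderiv1 k)^[ℓ k] h) (fun x => a * g x + h x) =
      fun x => a * L.foldr (fun k h => (pderiv1 k)^[ℓ k] h) g x +
        L.foldr (fun k h => (pderiv1 k)^[ℓ k] h) h x := by
  induction L with
  | nil => rfl
  | cons k L ih =>
    simp only [List.map_cons, List.sum_cons] at hg hh
    have hle : (((L.map ℓ).sum : ℕ) : WithTop ℕ∞) ≤ ((ℓ k + (L.map ℓ).sum : ℕ) : WithTop ℕ∞) := by
      exact_mod_cast Nat.le_add_left _ _
    simp only [List.foldr_cons]
    rw [ih (hg.of_le hle) (hh.of_le hle)]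
    exact iterate_pderiv1_const_mul_add k a (ℓ k) (contDiff_foldr_pderiv1 ℓ L hg)
      (contDiff_foldr_pderiv1 ℓ L hh)

lemma sum_map_finRange (ℓ : Fin d → ℕ) : ((List.finRange d).map ℓ).sum = ∑ k, ℓ k := by
  rw [← List.ofFn_eq_map, List.sum_ofFn]

variable {s : ℕ} {ℓ : Fin d → ℕ}

lemma mpderiv_const_mul_add (hℓ : ∑ k, ℓ k ≤ s) (a : ℝ) {g h : (Fin d → ℝ) → ℝ}
    (hg : ContDiff ℝ (s : WithTop ℕ∞) g) (hh : ContDiff ℝ (s : WithTop ℕ∞) h) :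
    mpderiv ℓ (fun x => a * g x + h x) = fun x => a * mpderiv ℓ g x + mpderiv ℓ h x := by
  have hle : ((((List.finRange d).map ℓ).sum : ℕ) : WithTop ℕ∞) ≤ (s : WithTop ℕ∞) := by
    rw [sum_map_finRange]; exact_mod_cast hℓ
  exact foldr_pderiv1_const_mul_add ℓ a _ (hg.of_le hle) (hh.of_le hle)

lemma continuous_mpderiv (hℓ : ∑ k, ℓ k ≤ s) {g : (Fin d → ℝ) → ℝ}
    (hg : ContDiff ℝ (s : WithTop ℕ∞) g) : Continuous (mpderiv ℓ g) := by
  have hle : ((0 + ((List.finRange d).map ℓ).sum : ℕ) : WithTop ℕ∞) ≤ (s : WithTop ℕ∞) := by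
    rw [sum_map_finRange, zero_add]; exact_mod_cast hℓ
  exact (contDiff_foldr_pderiv1 (r := 0) ℓ _ (hg.of_le hle)).continuous

lemma mpderiv_zero_index (g : (Fin d → ℝ) → ℝ) : mpderiv (fun _ => 0) g = g := by
  unfold mpderiv
  induction List.finRange d with
  | nil => rfl
  | cons k L ih => simp

lemma mpderiv_sum_sub (hℓ : ∑ k, ℓ k ≤ s) {ι : Type*} (S : Finset ι)
    {φ : ι → (Fin d → ℝ) → ℝ} (hφ : ∀ j, ContDiff ℝ (s : WithTop ℕ∞) (φ j)) (c : ι → ℝ)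
    {g : (Fin d → ℝ) → ℝ} (hg : ContDiff ℝ (s : WithTop ℕ∞) g) :
    mpderiv ℓ (fun x => ∑ j ∈ S, φ j x * c j - g x) =
      fun x => ∑ j ∈ S, mpderiv ℓ (φ j) x * c j - mpderiv ℓ g x := by
  classical
  induction S using Finset.induction_on with
  | empty =>
    have h1 : mpderiv ℓ (fun x => (-2) * g x + g x) = fun x => _ :=
      mpderiv_const_mul_add hℓ (-2) hg hg
    simp only [Finset.sum_empty, zero_sub]
    convert h1 using 2
    · funext x; ring
    · ring
  | insert j S hj ih =>
    have hrest : ContDiff ℝ (s : WithTop ℕ∞) (fun x => ∑ j ∈ S, φ j x * c j - g x) :=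
      (ContDiff.sum fun j _ => (hφ j).mul contDiff_const).sub hg
    have h1 := mpderiv_const_mul_add hℓ (c j) (hφ j) hrest
    rw [ih] at h1
    simp only [Finset.sum_insert hj]
    convert h1 using 2
    · funext x; ring
    · ring

end MultiIndexDerivatives

section SobolevNorm

variable {d : ℕ} {s : ℕ} {X : Set (Fin d → ℝ)}

instance finite_multiIndex : Finite {ℓ : Fin d → ℕ // ∑ k, ℓ k ≤ s} := by
  refine Set.Finite.to_subtype ((Set.finite_Iic (fun _ : Fin d => s)).subset ?_)
  intro ℓ hℓ k
  exact (Finset.single_le_sum (fun i _ => Nat.zero_le (ℓ i)) (Finset.mem_univ k)).trans hℓ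

lemma le_iSup_iSup_of_continuous (hX : IsCompact X) {ι : Type*} [Finite ι]
    {F : ι → (Fin d → ℝ) → ℝ} (hF : ∀ i, Continuous (F i)) (i : ι) {x : Fin d → ℝ}
    (hx : x ∈ X) : F i x ≤ ⨆ i, ⨆ x : X, F i x := by
  have hb : BddAbove (Set.range fun x : X => F i x) := by
    have := hX.bddAbove_image (hF i).continuousOn
    rwa [Set.image_eq_range] at this
  exact (le_ciSup hb ⟨x, hx⟩).trans
    (le_ciSup (f := fun i => ⨆ x : X, F i x) (Set.finite_range _).bddAbove i)

lemma abs_mpderiv_le_sobNorm (hX : IsCompact X) {g : (Fin d → ℝ) → ℝ}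
    (hg : ContDiff ℝ (s : WithTop ℕ∞) g) {ℓ : Fin d → ℕ} (hℓ : ∑ k, ℓ k ≤ s)
    {x : Fin d → ℝ} (hx : x ∈ X) : |mpderiv ℓ g x| ≤ sobNorm s X g :=
  le_iSup_iSup_of_continuous hX
    (F := fun (ℓ : {ℓ : Fin d → ℕ // ∑ k, ℓ k ≤ s}) x => |mpderiv ℓ.1 g x|)
    (fun ℓ => (continuous_mpderiv ℓ.2 hg).abs) ⟨ℓ, hℓ⟩ hx

lemma abs_le_sobNorm (hX : IsCompact X) {g : (Fin d → ℝ) → ℝ}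
    (hg : ContDiff ℝ (s : WithTop ℕ∞) g) {x : Fin d → ℝ} (hx : x ∈ X) :
    |g x| ≤ sobNorm s X g := by
  have h := abs_mpderiv_le_sobNorm hX hg (ℓ := fun _ => 0) (by simp) hx
  rwa [mpderiv_zero_index] at h

lemma sobNorm_nonneg (g : (Fin d → ℝ) → ℝ) : 0 ≤ sobNorm s X g :=
  Real.iSup_nonneg fun _ => Real.iSup_nonneg fun _ => abs_nonneg _

lemma sqrt_sum_mpderiv_le_zetaS (hX : IsCompact X) {P : ℕ} {φ : Fin P → (Fin d → ℝ) → ℝ}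
    (hφ : ∀ j, ContDiff ℝ (s : WithTop ℕ∞) (φ j)) {ℓ : Fin d → ℕ} (hℓ : ∑ k, ℓ k ≤ s)
    {x : Fin d → ℝ} (hx : x ∈ X) :
    √(∑ j, (mpderiv ℓ (φ j) x) ^ 2) ≤ zetaS s X φ :=
  le_iSup_iSup_of_continuous hX
    (F := fun (ℓ : {ℓ : Fin d → ℕ // ∑ k, ℓ k ≤ s}) x => √(∑ j, (mpderiv ℓ.1 (φ j) x) ^ 2))
    (fun ℓ => (continuous_finsetSum _ fun j _ => (continuous_mpderiv ℓ.2 (hφ j)).pow 2).sqrt)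
    ⟨ℓ, hℓ⟩ hx

lemma zetaS_nonneg {P : ℕ} (φ : Fin P → (Fin d → ℝ) → ℝ) : 0 ≤ zetaS s X φ :=
  Real.iSup_nonneg fun _ => Real.iSup_nonneg fun _ => Real.sqrt_nonneg _

lemma sq_apply_le_zetaS_sq (hX : IsCompact X) {P : ℕ} {φ : Fin P → (Fin d → ℝ) → ℝ}
    (hφ : ∀ j, ContDiff ℝ (s : WithTop ℕ∞) (φ j)) (j : Fin P) {x : Fin d → ℝ} (hx : x ∈ X) :
    (φ j x) ^ 2 ≤ zetaS s X φ ^ 2 := by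
  have h := sqrt_sum_mpderiv_le_zetaS hX hφ (ℓ := fun _ => 0) (by simp) hx
  simp only [mpderiv_zero_index] at h
  calc (φ j x) ^ 2 ≤ ∑ j, (φ j x) ^ 2 :=
        Finset.single_le_sum (f := fun j => (φ j x) ^ 2) (fun _ _ => sq_nonneg _)
          (Finset.mem_univ j)
    _ ≤ zetaS s X φ ^ 2 := (Real.sqrt_le_left (zetaS_nonneg φ)).1 h

lemma sobNorm_sum_sub_le (hX : IsCompact X) {P : ℕ} {φ : Fin P → (Fin d → ℝ) → ℝ}
    (hφ : ∀ j, ContDiff ℝ (s : WithTop ℕ∞) (φ j)) (c : Fin P → ℝ) {g : (Fin d → ℝ) → ℝ}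
    (hg : ContDiff ℝ (s : WithTop ℕ∞) g) :
    sobNorm s X (fun x => ∑ j, φ j x * c j - g x) ≤
      zetaS s X φ * √(c ⬝ᵥ c) + sobNorm s X g := by
  have h0 : 0 ≤ zetaS s X φ * √(c ⬝ᵥ c) + sobNorm s X g :=
    add_nonneg (mul_nonneg (zetaS_nonneg φ) (Real.sqrt_nonneg _)) (sobNorm_nonneg g)
  refine Real.iSup_le (fun ℓ => Real.iSup_le (fun x => ?_) h0) h0
  rw [mpderiv_sum_sub ℓ.2 _ hφ c hg]
  refine (abs_sub _ _).trans (add_le_add ?_ (abs_mpderiv_le_sobNorm hX hg ℓ.2 x.2))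
  calc |∑ j, mpderiv ℓ.1 (φ j) x * c j|
      ≤ √((∑ j, (mpderiv ℓ.1 (φ j) x) ^ 2) * ∑ j, c j ^ 2) :=
        Real.abs_le_sqrt (Finset.sum_mul_sq_le_sq_mul_sq _ _ _)
    _ = √(∑ j, (mpderiv ℓ.1 (φ j) x) ^ 2) * √(c ⬝ᵥ c) := by
        rw [Real.sqrt_mul (Finset.sum_nonneg fun _ _ => sq_nonneg _)]
        simp only [dotProduct, sq]
    _ ≤ zetaS s X φ * √(c ⬝ᵥ c) :=
        mul_le_mul_of_nonneg_right (sqrt_sum_mpderiv_le_zetaS hX hφ ℓ.2 x.2)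
          (Real.sqrt_nonneg _)

end SobolevNorm

section LinearAlgebra

variable {m p : Type*} [Fintype m] [Fintype p]

lemma dotProduct_self_nonneg_real (x : m → ℝ) : 0 ≤ x ⬝ᵥ x :=
  Finset.sum_nonneg fun i _ => mul_self_nonneg (x i)

lemma abs_dotProduct_mulVec_le (M : Matrix m m ℝ) {x : m → ℝ} (hx : x ⬝ᵥ x = 1) :
    |x ⬝ᵥ M.mulVec x| ≤ ∑ i, ∑ j, |M i j| := by
  have hx1 : ∀ i, |x i| ≤ 1 := fun i => by
    have : x i * x i ≤ 1 := hx ▸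
      Finset.single_le_sum (f := fun i => x i * x i) (fun i _ => mul_self_nonneg (x i))
        (Finset.mem_univ i)
    exact abs_le_one_iff_mul_self_le_one.2 this
  simp only [dotProduct, mulVec, Finset.mul_sum]
  refine (Finset.abs_sum_le_sum_abs _ _).trans (Finset.sum_le_sum fun i _ => ?_)
  refine (Finset.abs_sum_le_sum_abs _ _).trans (Finset.sum_le_sum fun j _ => ?_)
  rw [abs_mul, abs_mul]
  calc |x i| * (|M i j| * |x j|) ≤ 1 * (|M i j| * 1) := by
        gcongr
        · exact hx1 i
        · exact hx1 j
    _ = |M i j| := by ring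

lemma exists_unit_smul {x : m → ℝ} (hx : x ≠ 0) :
    ∃ (c : ℝ) (u : m → ℝ), u ⬝ᵥ u = 1 ∧ x = c • u := by
  have hpos : 0 < x ⬝ᵥ x :=
    (dotProduct_self_nonneg_real x).lt_of_ne fun h => hx (dotProduct_self_eq_zero.1 h.symm)
  have hs : √(x ⬝ᵥ x) ≠ 0 := (Real.sqrt_pos.2 hpos).ne'
  refine ⟨√(x ⬝ᵥ x), (√(x ⬝ᵥ x))⁻¹ • x, ?_, by rw [smul_smul, mul_inv_cancel₀ hs, one_smul]⟩
  rw [smul_dotProduct, dotProduct_smul, smul_smul, ← mul_inv, Real.mul_self_sqrt hpos.le,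
    smul_eq_mul, inv_mul_cancel₀ hpos.ne']

lemma eigMin_mul_le (M : Matrix m m ℝ) (x : m → ℝ) :
    eigMin M * (x ⬝ᵥ x) ≤ x ⬝ᵥ M.mulVec x := by
  by_cases hx : x = 0
  · simp [hx]
  obtain ⟨c, u, hu, rfl⟩ := exists_unit_smul hx
  have hle : eigMin M ≤ u ⬝ᵥ M.mulVec u := by
    refine csInf_le ⟨-∑ i, ∑ j, |M i j|, ?_⟩ ⟨u, hu, rfl⟩
    rintro r ⟨y, hy, rfl⟩
    exact (abs_le.1 (abs_dotProduct_mulVec_le M hy)).1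
  simp only [mulVec_smul, smul_dotProduct, dotProduct_smul, smul_eq_mul, hu]
  nlinarith [mul_self_nonneg c]

lemma le_eigMax_mul (M : Matrix m m ℝ) (x : m → ℝ) :
    x ⬝ᵥ M.mulVec x ≤ eigMax M * (x ⬝ᵥ x) := by
  by_cases hx : x = 0
  · simp [hx]
  obtain ⟨c, u, hu, rfl⟩ := exists_unit_smul hx
  have hle : u ⬝ᵥ M.mulVec u ≤ eigMax M := by
    refine le_csSup ⟨∑ i, ∑ j, |M i j|, ?_⟩ ⟨u, hu, rfl⟩
    rintro r ⟨y, hy, rfl⟩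
    exact (abs_le.1 (abs_dotProduct_mulVec_le M hy)).2
  simp only [mulVec_smul, smul_dotProduct, dotProduct_smul, smul_eq_mul, hu]
  nlinarith [mul_self_nonneg c]

lemma trace_mul_mul_transpose_le (S : Matrix m m ℝ) (B : Matrix p m ℝ) :
    (B * S * Bᵀ).trace ≤ eigMax S * (B * Bᵀ).trace := by
  simp only [trace, Finset.mul_sum]
  refine Finset.sum_le_sum fun i _ => ?_
  have h := le_eigMax_mul S (B i)
  rw [dotProduct_mulVec] at h
  exact h

lemma dotProduct_mulVec_transpose_mul (Ψ : Matrix m p ℝ) (b c : p → ℝ) :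
    b ⬝ᵥ (Ψᵀ * Ψ).mulVec c = Ψ.mulVec b ⬝ᵥ Ψ.mulVec c := by
  rw [← mulVec_mulVec, dotProduct_mulVec, vecMul_transpose]

lemma dotProduct_self_le_of_eigMin {Ψ : Matrix m p ℝ} {N : ℕ}
    (heig : (1 : ℝ) / 2 ≤ eigMin ((N : ℝ)⁻¹ • (Ψᵀ * Ψ))) (b : p → ℝ) :
    b ⬝ᵥ b ≤ 2 / N * (Ψ.mulVec b ⬝ᵥ Ψ.mulVec b) := by
  have h1 := eigMin_mul_le ((N : ℝ)⁻¹ • (Ψᵀ * Ψ)) b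
  rw [smul_mulVec, dotProduct_smul, dotProduct_mulVec_transpose_mul, smul_eq_mul] at h1
  have h2 := mul_le_mul_of_nonneg_right heig (dotProduct_self_nonneg_real b)
  rw [div_eq_mul_inv]
  linarith

variable [DecidableEq p] {Ψ : Matrix m p ℝ}

lemma mulVec_lsq_dotProduct_self_le (hΨ : IsUnit (Ψᵀ * Ψ).det) (v : m → ℝ) :
    Ψ.mulVec ((Ψᵀ * Ψ)⁻¹.mulVec (Ψᵀ.mulVec v)) ⬝ᵥ
      Ψ.mulVec ((Ψᵀ * Ψ)⁻¹.mulVec (Ψᵀ.mulVec v)) ≤ v ⬝ᵥ v := by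
  set b := (Ψᵀ * Ψ)⁻¹.mulVec (Ψᵀ.mulVec v) with hb
  have hA : (Ψᵀ * Ψ).mulVec b = Ψᵀ.mulVec v := by
    rw [hb, mulVec_mulVec, mul_nonsing_inv _ hΨ, one_mulVec]
  have h1 : Ψ.mulVec b ⬝ᵥ Ψ.mulVec b = Ψ.mulVec b ⬝ᵥ v := by
    rw [← dotProduct_mulVec_transpose_mul, hA, dotProduct_mulVec, vecMul_transpose]
  have h2 := dotProduct_self_nonneg_real (v - Ψ.mulVec b)
  rw [sub_dotProduct, dotProduct_sub, dotProduct_sub, dotProduct_comm v (Ψ.mulVec b)] at h2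
  linarith

lemma lsq_mulVec (hΨ : IsUnit (Ψᵀ * Ψ).det) (b : p → ℝ) :
    (Ψᵀ * Ψ)⁻¹.mulVec (Ψᵀ.mulVec (Ψ.mulVec b)) = b := by
  rw [mulVec_mulVec _ Ψᵀ, mulVec_mulVec, nonsing_inv_mul _ hΨ, one_mulVec]

lemma trace_hat_mul_transpose (hΨ : IsUnit (Ψᵀ * Ψ).det) :
    ((Ψ * (Ψᵀ * Ψ)⁻¹ * Ψᵀ) * (Ψ * (Ψᵀ * Ψ)⁻¹ * Ψᵀ)ᵀ).trace = Fintype.card p := by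
  have hsymm : (Ψ * (Ψᵀ * Ψ)⁻¹ * Ψᵀ)ᵀ = Ψ * (Ψᵀ * Ψ)⁻¹ * Ψᵀ := by
    simp [transpose_nonsing_inv, Matrix.mul_assoc]
  have hidem : (Ψ * (Ψᵀ * Ψ)⁻¹ * Ψᵀ) * (Ψ * (Ψᵀ * Ψ)⁻¹ * Ψᵀ) =
      Ψ * ((Ψᵀ * Ψ)⁻¹ * (Ψᵀ * Ψ)) * ((Ψᵀ * Ψ)⁻¹ * Ψᵀ) := by
    simp only [Matrix.mul_assoc]
  rw [hsymm, hidem, nonsing_inv_mul _ hΨ, Matrix.mul_one, trace_mul_comm, Matrix.mul_assoc,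
    nonsing_inv_mul _ hΨ, trace_one]

end LinearAlgebra

section QuadraticForms

lemma integral_averaged_mul {Ω : Type*} [MeasurableSpace Ω] {μ : Measure Ω} {n : ℕ}
    {τ : Type*} {ε : Fin n → Ω → τ → ℝ} {S : Fin n → Matrix τ τ ℝ}
    (hint : ∀ i i' t t', Integrable (fun ω => ε i ω t * ε i' ω t') μ)
    (hcov : ∀ i t t', ∫ ω, ε i ω t * ε i ω t' ∂μ = S i t t')
    (huncorr : ∀ i i', i ≠ i' → ∀ t t', ∫ ω, ε i ω t * ε i' ω t' ∂μ = 0) (t t' : τ) :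
    Integrable (fun ω => ((n : ℝ)⁻¹ * ∑ i, ε i ω t) * ((n : ℝ)⁻¹ * ∑ i, ε i ω t')) μ ∧
    ∫ ω, ((n : ℝ)⁻¹ * ∑ i, ε i ω t) * ((n : ℝ)⁻¹ * ∑ i, ε i ω t') ∂μ =
      (n : ℝ)⁻¹ * ((n : ℝ)⁻¹ • ∑ i, S i) t t' := by
  have hexp : ∀ ω, ((n : ℝ)⁻¹ * ∑ i, ε i ω t) * ((n : ℝ)⁻¹ * ∑ i, ε i ω t') =
      (n : ℝ)⁻¹ * ((n : ℝ)⁻¹ * ∑ i, ∑ i', ε i ω t * ε i' ω t') := fun ω => by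
    rw [← Finset.sum_mul_sum]; ring
  have hinner : ∀ i, Integrable (fun ω => ∑ i', ε i ω t * ε i' ω t') μ :=
    fun i => integrable_finsetSum _ fun i' _ => hint i i' t t'
  simp only [hexp]
  refine ⟨((integrable_finsetSum _ fun i _ => hinner i).const_mul _).const_mul _, ?_⟩
  rw [integral_const_mul, integral_const_mul, integral_finsetSum _ fun i _ => hinner i]
  simp only [Matrix.smul_apply, Matrix.sum_apply, smul_eq_mul]
  congr 2
  refine Finset.sum_congr rfl fun i _ => ?_
  rw [integral_finsetSum _ fun i' _ => hint i i' t t',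
    Finset.sum_eq_single i (fun i' _ h => huncorr i i' h.symm t t') (by simp), hcov]

lemma integral_mulVec_dotProduct_self {Ω : Type*} [MeasurableSpace Ω] {μ : Measure Ω}
    {τ p : Type*} [Fintype τ] [Fintype p] {v : Ω → τ → ℝ} {S : Matrix τ τ ℝ}
    (hint : ∀ t t', Integrable (fun ω => v ω t * v ω t') μ)
    (hcov : ∀ t t', ∫ ω, v ω t * v ω t' ∂μ = S t t') (B : Matrix p τ ℝ) :
    Integrable (fun ω => B.mulVec (v ω) ⬝ᵥ B.mulVec (v ω)) μ ∧
    ∫ ω, B.mulVec (v ω) ⬝ᵥ B.mulVec (v ω) ∂μ = (B * S * Bᵀ).trace := by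
  have hexp : ∀ ω, B.mulVec (v ω) ⬝ᵥ B.mulVec (v ω) =
      ∑ i, ∑ t', ∑ t, B i t * B i t' * (v ω t * v ω t') := fun ω => by
    simp only [dotProduct, mulVec]
    refine Finset.sum_congr rfl fun i _ => ?_
    rw [Finset.sum_mul_sum, Finset.sum_comm]
    exact Finset.sum_congr rfl fun t' _ => Finset.sum_congr rfl fun t _ => by ring
  have h0 : ∀ i t' t, Integrable (fun ω => B i t * B i t' * (v ω t * v ω t')) μ :=
    fun i t' t => (hint t t').const_mul _
  have h1 : ∀ i t', Integrable (fun ω => ∑ t, B i t * B i t' * (v ω t * v ω t')) μ :=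
    fun i t' => integrable_finsetSum _ fun t _ => h0 i t' t
  have h2 : ∀ i, Integrable (fun ω => ∑ t', ∑ t, B i t * B i t' * (v ω t * v ω t')) μ :=
    fun i => integrable_finsetSum _ fun t' _ => h1 i t'
  simp only [hexp]
  refine ⟨integrable_finsetSum _ fun i _ => h2 i, ?_⟩
  rw [integral_finsetSum _ fun i _ => h2 i]
  simp only [trace, diag_apply, mul_apply, transpose_apply, Finset.sum_mul]
  refine Finset.sum_congr rfl fun i _ => ?_
  rw [integral_finsetSum _ fun t' _ => h1 i t']
  refine Finset.sum_congr rfl fun t' _ => ?_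
  rw [integral_finsetSum _ fun t _ => h0 i t' t]
  refine Finset.sum_congr rfl fun t _ => ?_
  rw [integral_const_mul, hcov]
  ring

end QuadraticForms

section SingleExperiment

variable {d : ℕ} {s : ℕ} {X : Set (Fin d → ℝ)} {T P : ℕ} {ψ : Fin P → (Fin d → ℝ) → ℝ}
  {x : Fin T → Fin d → ℝ} {Ψ : Matrix (Fin T) (Fin P) ℝ}

lemma one_le_two_mul_zetaS_sq (hX : IsCompact X) (hT : 0 < T) (hP : 0 < P)
    (hψ : ∀ j, ContDiff ℝ (s : WithTop ℕ∞) (ψ j)) (hx : ∀ t, x t ∈ X)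
    (hΨdef : ∀ t j, Ψ t j = ψ j (x t))
    (heig : (1 : ℝ) / 2 ≤ eigMin ((T : ℝ)⁻¹ • (Ψᵀ * Ψ))) :
    1 ≤ 2 * zetaS s X ψ ^ 2 := by
  have hT' : (0 : ℝ) < T := by exact_mod_cast hT
  have h := dotProduct_self_le_of_eigMin heig (Pi.single ⟨0, hP⟩ 1)
  rw [single_one_dotProduct, Pi.single_eq_same, mulVec_single_one] at h
  have hsum : Ψ.col ⟨0, hP⟩ ⬝ᵥ Ψ.col ⟨0, hP⟩ ≤ T * zetaS s X ψ ^ 2 := by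
    calc Ψ.col ⟨0, hP⟩ ⬝ᵥ Ψ.col ⟨0, hP⟩ ≤ ∑ _t : Fin T, zetaS s X ψ ^ 2 := by
          refine Finset.sum_le_sum fun t _ => ?_
          simpa [hΨdef, sq] using sq_apply_le_zetaS_sq hX hψ ⟨0, hP⟩ (hx t)
      _ = T * zetaS s X ψ ^ 2 := by simp
  calc (1 : ℝ) ≤ 2 / T * (Ψ.col ⟨0, hP⟩ ⬝ᵥ Ψ.col ⟨0, hP⟩) := h
    _ ≤ 2 / T * (T * zetaS s X ψ ^ 2) := by gcongr
    _ = 2 * zetaS s X ψ ^ 2 := by field_simp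

lemma dotProduct_add_self_le {m : Type*} [Fintype m] (a b : m → ℝ) :
    (a + b) ⬝ᵥ (a + b) ≤ 2 * (a ⬝ᵥ a) + 2 * (b ⬝ᵥ b) := by
  have h := dotProduct_self_nonneg_real (a - b)
  simp only [sub_dotProduct, dotProduct_sub, add_dotProduct, dotProduct_add] at h ⊢
  linarith

/-- Bias-variance bound for the least-squares sieve estimator with additive noise `v`. -/
lemma sobNorm_lsq_sub_le (hX : IsCompact X) (hT : 0 < T)
    {f : (Fin d → ℝ) → ℝ} (hf : ContDiff ℝ (s : WithTop ℕ∞) f)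
    (hψ : ∀ j, ContDiff ℝ (s : WithTop ℕ∞) (ψ j)) (hx : ∀ t, x t ∈ X)
    (hΨdef : ∀ t j, Ψ t j = ψ j (x t)) (hΨ : IsUnit (Ψᵀ * Ψ).det)
    (heig : (1 : ℝ) / 2 ≤ eigMin ((T : ℝ)⁻¹ • (Ψᵀ * Ψ))) (β : Fin P → ℝ) (v : Fin T → ℝ) :
    sobNorm s X (fun y => (∑ j, ψ j y *
        ((Ψᵀ * Ψ)⁻¹.mulVec (Ψᵀ.mulVec (fun t => f (x t) + v t))) j) - f y) ≤
      zetaS s X ψ * (2 * sobNorm s X (fun y => f y - ∑ j, ψ j y * β j) +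
        √(2 * (2 / T * ((Ψ * (Ψᵀ * Ψ)⁻¹ * Ψᵀ).mulVec v ⬝ᵥ (Ψ * (Ψᵀ * Ψ)⁻¹ * Ψᵀ).mulVec v)))) +
      sobNorm s X (fun y => f y - ∑ j, ψ j y * β j) := by
  have hT' : (0 : ℝ) < T := by exact_mod_cast hT
  set g : (Fin d → ℝ) → ℝ := fun y => f y - ∑ j, ψ j y * β j with hg
  have hgs : ContDiff ℝ (s : WithTop ℕ∞) g :=
    hf.sub (ContDiff.sum fun j _ => (hψ j).mul contDiff_const)
  set N := sobNorm s X g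
  have hN : 0 ≤ N := sobNorm_nonneg g
  set L : (Fin T → ℝ) → Fin P → ℝ := fun w => (Ψᵀ * Ψ)⁻¹.mulVec (Ψᵀ.mulVec w) with hL
  set r : Fin T → ℝ := fun t => g (x t) with hr
  have hdecomp : L (fun t => f (x t) + v t) = β + (L r + L v) := by
    have hsum : (fun t => f (x t) + v t) = Ψ.mulVec β + (r + v) := by
      funext t
      simp only [hr, hg, Pi.add_apply, mulVec, dotProduct, hΨdef]
      ring
    simp only [hL, hsum, mulVec_add]
    rw [lsq_mulVec hΨ]
  have hfun : (fun y => (∑ j, ψ j y * L (fun t => f (x t) + v t) j) - f y) =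
      fun y => ∑ j, ψ j y * (L r + L v) j - g y := by
    funext y
    simp only [hdecomp, hg, Pi.add_apply, mul_add, Finset.sum_add_distrib]
    ring
  have hbias : L r ⬝ᵥ L r ≤ 2 * N ^ 2 := by
    have hrr : r ⬝ᵥ r ≤ T * N ^ 2 := by
      calc r ⬝ᵥ r ≤ ∑ _t : Fin T, N ^ 2 := by
            refine Finset.sum_le_sum fun t _ => ?_
            rw [← sq]
            exact sq_le_sq' (abs_le.1 (abs_le_sobNorm hX hgs (hx t))).1
              (abs_le.1 (abs_le_sobNorm hX hgs (hx t))).2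
        _ = T * N ^ 2 := by simp
    calc L r ⬝ᵥ L r ≤ 2 / T * (Ψ.mulVec (L r) ⬝ᵥ Ψ.mulVec (L r)) :=
          dotProduct_self_le_of_eigMin heig _
      _ ≤ 2 / T * (T * N ^ 2) := by
          gcongr
          exact (mulVec_lsq_dotProduct_self_le hΨ r).trans hrr
      _ = 2 * N ^ 2 := by field_simp
  have hnoise := dotProduct_self_le_of_eigMin heig (L v)
  have hhat : Ψ.mulVec (L v) = (Ψ * (Ψᵀ * Ψ)⁻¹ * Ψᵀ).mulVec v := by
    simp only [hL, mulVec_mulVec, Matrix.mul_assoc]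
  rw [hhat] at hnoise
  set Q := (Ψ * (Ψᵀ * Ψ)⁻¹ * Ψᵀ).mulVec v ⬝ᵥ (Ψ * (Ψᵀ * Ψ)⁻¹ * Ψᵀ).mulVec v
  have hQ : 0 ≤ 2 * (2 / (T : ℝ) * Q) := by
    have : 0 ≤ Q := dotProduct_self_nonneg_real _
    positivity
  have hcoef : √((L r + L v) ⬝ᵥ (L r + L v)) ≤ 2 * N + √(2 * (2 / T * Q)) := by
    refine Real.sqrt_le_iff.2 ⟨by positivity, ?_⟩
    have h1 := dotProduct_add_self_le (L r) (L v)
    have h2 := Real.sq_sqrt hQ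
    have h3 : 0 ≤ N * √(2 * (2 / T * Q)) := by positivity
    nlinarith
  rw [hfun]
  refine (sobNorm_sum_sub_le hX hψ _ hgs).trans ?_
  gcongr
  exact zetaS_nonneg ψ

lemma min_eigMax_trace_pos {S : Matrix (Fin T) (Fin T) ℝ} (hT : 0 < T) (hP : 0 < P)
    (hS : ∀ t, 0 < S t t) : 0 < min ((P : ℝ) * eigMax S) S.trace := by
  have hP' : (0 : ℝ) < P := by exact_mod_cast hP
  have h := le_eigMax_mul S (Pi.single ⟨0, hT⟩ 1)
  rw [single_one_dotProduct, single_one_dotProduct, mulVec_single_one, Pi.single_eq_same,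
    mul_one] at h
  refine lt_min (mul_pos hP' ((hS ⟨0, hT⟩).trans_le h)) ?_
  exact Finset.sum_pos (fun t _ => hS t) ⟨⟨0, hT⟩, Finset.mem_univ _⟩

lemma integral_hat_dotProduct_self_le {Ω : Type*} [MeasurableSpace Ω] {μ : Measure Ω}
    {v : Ω → Fin T → ℝ} {S : Matrix (Fin T) (Fin T) ℝ} {a : ℝ} (ha : 0 ≤ a)
    (hint : ∀ t t', Integrable (fun ω => v ω t * v ω t') μ)
    (hcov : ∀ t t', ∫ ω, v ω t * v ω t' ∂μ = a * S t t') (hΨ : IsUnit (Ψᵀ * Ψ).det) :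
    Integrable (fun ω => (Ψ * (Ψᵀ * Ψ)⁻¹ * Ψᵀ).mulVec (v ω) ⬝ᵥ
      (Ψ * (Ψᵀ * Ψ)⁻¹ * Ψᵀ).mulVec (v ω)) μ ∧
    ∫ ω, (Ψ * (Ψᵀ * Ψ)⁻¹ * Ψᵀ).mulVec (v ω) ⬝ᵥ (Ψ * (Ψᵀ * Ψ)⁻¹ * Ψᵀ).mulVec (v ω) ∂μ ≤
      a * min ((P : ℝ) * eigMax S) S.trace := by
  have hcov' : ∀ t t', ∫ ω, v ω t * v ω t' ∂μ = (a • S) t t' := hcov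
  obtain ⟨hI, hE⟩ := integral_mulVec_dotProduct_self hint hcov' (Ψ * (Ψᵀ * Ψ)⁻¹ * Ψᵀ)
  obtain ⟨hI1, hE1⟩ := integral_mulVec_dotProduct_self hint hcov' (1 : Matrix (Fin T) (Fin T) ℝ)
  refine ⟨hI, ?_⟩
  rw [mul_min_of_nonneg _ _ ha]
  refine le_min ?_ ?_
  · rw [hE, Matrix.mul_smul, Matrix.smul_mul, trace_smul, smul_eq_mul]
    have h := trace_mul_mul_transpose_le S (Ψ * (Ψᵀ * Ψ)⁻¹ * Ψᵀ)
    rw [trace_hat_mul_transpose hΨ, Fintype.card_fin, mul_comm] at h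
    exact mul_le_mul_of_nonneg_left h ha
  · have hle := integral_mono hI hI1 fun ω => by
      simpa [mulVec_mulVec, Matrix.mul_assoc] using mulVec_lsq_dotProduct_self_le hΨ (v ω)
    rw [hE1] at hle
    simpa [trace_smul] using hle

lemma measure_lt_of_sq_integral_le {Ω : Type*} [MeasurableSpace Ω] {μ : Measure Ω}
    [IsFiniteMeasure μ] {Y : Ω → ℝ} {R C : ℝ} (hY : ∀ ω, 0 ≤ Y ω) (hI : Integrable Y μ)
    (hR : 0 < R) (hC : 0 < C) (hE : ∫ ω, Y ω ∂μ ≤ 4 * R ^ 2) :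
    μ {ω | C * R < √(Y ω)} ≤ ENNReal.ofReal (4 / C ^ 2) := by
  have hsub : {ω | C * R < √(Y ω)} ⊆ {ω | (C * R) ^ 2 ≤ Y ω} := fun ω hω =>
    ((Real.lt_sqrt (by positivity)).1 hω).le
  refine (measure_mono hsub).trans ?_
  rw [← ofReal_measureReal]
  refine ENNReal.ofReal_le_ofReal ?_
  have h := (mul_meas_ge_le_integral_of_nonneg (Eventually.of_forall hY) hI ((C * R) ^ 2)).trans hE
  rw [le_div_iff₀ (by positivity)]
  have hR2 : 0 < R ^ 2 := by positivity
  refine le_of_mul_le_mul_right ?_ hR2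
  calc _ = (C * R) ^ 2 * μ.real {ω | (C * R) ^ 2 ≤ Y ω} := by ring
    _ ≤ _ := h

/-- Tail bound for the sieve estimator in a single experiment. -/
lemma measure_sieve_error_le {Ω : Type*} [MeasurableSpace Ω] {μ : Measure Ω}
    [IsProbabilityMeasure μ] (hX : IsCompact X) {n : ℕ} (hn : 0 < n) (hT : 0 < T) (hP : 0 < P)
    {f : (Fin d → ℝ) → ℝ} (hf : ContDiff ℝ (s : WithTop ℕ∞) f)
    (hψ : ∀ j, ContDiff ℝ (s : WithTop ℕ∞) (ψ j)) (hx : ∀ t, x t ∈ X)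
    (hΨdef : ∀ t j, Ψ t j = ψ j (x t)) (hΨ : IsUnit (Ψᵀ * Ψ).det)
    (heig : (1 : ℝ) / 2 ≤ eigMin ((T : ℝ)⁻¹ • (Ψᵀ * Ψ))) (β : Fin P → ℝ)
    {v : Ω → Fin T → ℝ} {S : Matrix (Fin T) (Fin T) ℝ} (hS : ∀ t, 0 < S t t)
    (hint : ∀ t t', Integrable (fun ω => v ω t * v ω t') μ)
    (hcov : ∀ t t', ∫ ω, v ω t * v ω t' ∂μ = (n : ℝ)⁻¹ * S t t') {C : ℝ} (hC : 2 ≤ C) :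
    μ {ω | C * (zetaS s X ψ * √(min ((P : ℝ) * eigMax S) S.trace / ((n : ℝ) * T)) +
          (zetaS s X ψ + 1) * sobNorm s X (fun y => f y - ∑ j, ψ j y * β j)) <
        sobNorm s X (fun y => (∑ j, ψ j y *
          ((Ψᵀ * Ψ)⁻¹.mulVec (Ψᵀ.mulVec (fun t => f (x t) + v ω t))) j) - f y)} ≤
      ENNReal.ofReal (4 / C ^ 2) := by
  have hT' : (0 : ℝ) < T := by exact_mod_cast hT
  have hn' : (0 : ℝ) < n := by exact_mod_cast hn
  obtain ⟨hI, hE⟩ := integral_hat_dotProduct_self_le (inv_nonneg.2 hn'.le) hint hcov hΨ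
  have hm := min_eigMax_trace_pos hT hP hS
  set m := min ((P : ℝ) * eigMax S) S.trace
  set Q : Ω → ℝ := fun ω => (Ψ * (Ψᵀ * Ψ)⁻¹ * Ψᵀ).mulVec (v ω) ⬝ᵥ
    (Ψ * (Ψᵀ * Ψ)⁻¹ * Ψᵀ).mulVec (v ω)
  have hQ : ∀ ω, 0 ≤ Q ω := fun ω => dotProduct_self_nonneg_real _
  have hR : 0 < m / ((n : ℝ) * T) := by positivity
  refine (measure_mono fun ω hω => ?_).trans (measure_lt_of_sq_integral_le
    (Y := fun ω => 2 * (2 / T * Q ω)) (R := √(m / ((n : ℝ) * T)))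
    (fun ω => by have := hQ ω; positivity) ((hI.const_mul _).const_mul _)
    (Real.sqrt_pos.2 hR) (by linarith) ?_)
  · have hle := sobNorm_lsq_sub_le hX hT hf hψ hx hΨdef hΨ heig β (v ω)
    have hlt := lt_of_lt_of_le hω hle
    have hz := zetaS_nonneg (s := s) (X := X) ψ
    set N := sobNorm s X (fun y => f y - ∑ j, ψ j y * β j)
    have hN : 0 ≤ N := sobNorm_nonneg _
    have h1 : 0 ≤ (C - 2) * ((zetaS s X ψ + 1) * N) :=
      mul_nonneg (by linarith) (by positivity)
    refine lt_of_mul_lt_mul_left ?_ hz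
    linarith
  · rw [integral_const_mul, integral_const_mul, Real.sq_sqrt hR.le]
    calc 2 * (2 / T * ∫ ω, Q ω ∂μ) ≤ 2 * (2 / T * ((n : ℝ)⁻¹ * m)) := by gcongr
      _ = 4 * (m / ((n : ℝ) * T)) := by field_simp; norm_num

end SingleExperiment

theorem sieve_consistency
    {d : ℕ} (s : ℕ) (X : Set (Fin d → ℝ)) (hX : IsCompact X)
    (f : (Fin d → ℝ) → ℝ) (hf : ContDiff ℝ (s : ℕ∞) f)
    (n T P : ℕ → ℕ) (hn : ∀ k, 0 < n k) (hT : ∀ k, 0 < T k) (hP : ∀ k, 0 < P k)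
    (Ω : ℕ → Type*) [∀ k, MeasurableSpace (Ω k)]
    (μ : ∀ k, Measure (Ω k)) [∀ k, IsProbabilityMeasure (μ k)]
    (ψ : ∀ k, Fin (P k) → (Fin d → ℝ) → ℝ)
    (hψ : ∀ k j, ContDiff ℝ (s : ℕ∞) (ψ k j))
    (Xpts : ∀ k, Fin (T k) → (Fin d → ℝ)) (hXpts : ∀ k t, Xpts k t ∈ X)
    (Ψ : ∀ k, Matrix (Fin (T k)) (Fin (P k)) ℝ)
    (hΨdef : ∀ k t j, Ψ k t j = ψ k j (Xpts k t))
    (hΨinv : ∀ k, IsUnit ((Ψ k)ᵀ * Ψ k).det)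
    (ε : ∀ k, Fin (n k) → Ω k → Fin (T k) → ℝ)
    (Sigm : ∀ k, Fin (n k) → Matrix (Fin (T k)) (Fin (T k)) ℝ)
    (hmeas : ∀ k i, Measurable (ε k i))
    (hint : ∀ k i i' t t', Integrable (fun ω => ε k i ω t * ε k i' ω t') (μ k))
    (hmean : ∀ k i t, ∫ ω, ε k i ω t ∂(μ k) = 0)
    (hcov : ∀ k i t t', ∫ ω, ε k i ω t * ε k i ω t' ∂(μ k) = Sigm k i t t')
    (hpd : ∀ k i, (Sigm k i).PosDef)
    (huncorr : ∀ k i i', i ≠ i' → ∀ t t',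
      ∫ ω, ε k i ω t * ε k i' ω t' ∂(μ k) = 0)
    (β₀ : ∀ k, Fin (P k) → ℝ)
    -- named auxiliary quantities
    (lam tau Nse zs : ℕ → ℝ)
    (hlam : ∀ k, lam k = eigMax ((n k : ℝ)⁻¹ • ∑ i, Sigm k i))
    (htau : ∀ k, tau k = Matrix.trace ((n k : ℝ)⁻¹ • ∑ i, Sigm k i))
    (hNse : ∀ k, Nse k = sobNorm s X (fun x => f x - ∑ j, ψ k j x * β₀ k j))
    (hzs : ∀ k, zs k = zetaS s X (ψ k))
    -- the estimation error as a random variable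
    (err : ∀ k, Ω k → ℝ)
    (herr : ∀ k ω, err k ω =
      sobNorm s X (fun x =>
        (∑ j, ψ k j x *
          (((Ψ k)ᵀ * Ψ k)⁻¹.mulVec ((Ψ k)ᵀ.mulVec
            (fun t => f (Xpts k t) + (n k : ℝ)⁻¹ * ∑ i, ε k i ω t))) j) - f x))
    -- Assumption 2 (i): smallest eigenvalue of the normalized design matrix
    -- bounded away from zero
    (heig : ∀ k, (1 : ℝ) / 2 ≤ eigMin (((T k : ℝ))⁻¹ • ((Ψ k)ᵀ * Ψ k)))
    -- Assumption 3 (i)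
    (hrate1 : Tendsto (fun k => zs k *
        Real.sqrt (min ((P k : ℝ) * lam k) (tau k) / ((n k : ℝ) * (T k : ℝ))))
      atTop (nhds 0))
    -- Assumption 3 (ii)
    (hrate2 : Tendsto (fun k => zs k * Nse k) atTop (nhds 0)) :
    (∀ δ : ℝ, 0 < δ →
        Tendsto (fun k => ((μ k) {ω | δ < err k ω}).toReal) atTop (nhds 0)) ∧
    (∀ e : ℝ, 0 < e → ∃ C : ℝ, 0 < C ∧ ∀ k,
        (μ k) {ω |
            C * (zs k *
                Real.sqrt (min ((P k : ℝ) * lam k) (tau k) /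
                  ((n k : ℝ) * (T k : ℝ))) +
              (zs k + 1) * Nse k) < err k ω} ≤ ENNReal.ofReal e) := by
  have hf' : ContDiff ℝ (s : WithTop ℕ∞) f := hf
  have hψ' : ∀ k j, ContDiff ℝ (s : WithTop ℕ∞) (ψ k j) := hψ
  have htail : ∀ C : ℝ, 2 ≤ C → ∀ k, (μ k) {ω | C * (zs k *
      Real.sqrt (min ((P k : ℝ) * lam k) (tau k) / ((n k : ℝ) * (T k : ℝ))) +
        (zs k + 1) * Nse k) < err k ω} ≤ ENNReal.ofReal (4 / C ^ 2) := by
    intro C hC k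
    have hn' : (0 : ℝ) < n k := by exact_mod_cast hn k
    have hdiag : ∀ t, 0 < ((n k : ℝ)⁻¹ • ∑ i, Sigm k i) t t := fun t => by
      rw [Matrix.smul_apply, Matrix.sum_apply, smul_eq_mul]
      exact mul_pos (inv_pos.2 hn')
        (Finset.sum_pos (fun i _ => (hpd k i).diag_pos) ⟨⟨0, hn k⟩, Finset.mem_univ _⟩)
    have hmoment := integral_averaged_mul (hint k) (hcov k) (huncorr k)
    simp only [herr, hlam, htau, hNse, hzs]
    exact measure_sieve_error_le hX (hn k) (hT k) (hP k) hf' (hψ' k) (hXpts k) (hΨdef k)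
      (hΨinv k) (heig k) (β₀ k) hdiag (fun t t' => (hmoment t t').1)
      (fun t t' => (hmoment t t').2) hC
  have hbound : ∀ e : ℝ, 0 < e → ∃ C : ℝ, 0 < C ∧ ∀ k, (μ k) {ω | C * (zs k *
      Real.sqrt (min ((P k : ℝ) * lam k) (tau k) / ((n k : ℝ) * (T k : ℝ))) +
        (zs k + 1) * Nse k) < err k ω} ≤ ENNReal.ofReal e := by
    intro e he
    have he' : 0 < 4 / e := by positivity
    refine ⟨2 + 4 / e, by positivity, fun k => (htail _ (by linarith) k).trans
      (ENNReal.ofReal_le_ofReal ?_)⟩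
    rw [div_le_comm₀ (by positivity) he]
    nlinarith
  refine ⟨fun δ hδ => ?_, hbound⟩
  have hN0 : Tendsto Nse atTop (nhds 0) := by
    have h2 : Tendsto (fun k => 2 * (zs k * Nse k)) atTop (nhds 0) := by
      simpa using hrate2.const_mul 2
    refine squeeze_zero (fun k => hNse k ▸ sobNorm_nonneg _) (fun k => ?_) h2
    have hz := one_le_two_mul_zetaS_sq hX (hT k) (hP k) (hψ' k) (hXpts k) (hΨdef k) (heig k)
    have hz0 : 0 ≤ zs k := hzs k ▸ zetaS_nonneg _
    have hN : 0 ≤ Nse k := hNse k ▸ sobNorm_nonneg _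
    rw [← hzs] at hz
    have hz1 : 1 ≤ 2 * zs k := by nlinarith
    nlinarith
  have hrate : Tendsto (fun k => zs k *
      Real.sqrt (min ((P k : ℝ) * lam k) (tau k) / ((n k : ℝ) * (T k : ℝ))) +
        (zs k + 1) * Nse k) atTop (nhds 0) := by
    simpa [add_mul] using hrate1.add (hrate2.add hN0)
  refine (nhds_basis_Icc_pos (0 : ℝ)).tendsto_right_iff.2 fun e he => ?_
  obtain ⟨C, -, hC⟩ := hbound e he
  have hCrate := hrate.const_mul C
  rw [mul_zero] at hCrate
  filter_upwards [hCrate.eventually (gt_mem_nhds hδ)] with k hk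
  have hle : (μ k) {ω | δ < err k ω} ≤ ENNReal.ofReal e :=
    (measure_mono fun ω hω => lt_trans hk hω).trans (hC k)
  exact ⟨by linarith [ENNReal.toReal_nonneg (a := (μ k) {ω | δ < err k ω})],
    by simpa using ENNReal.toReal_le_of_le_ofReal he.le hle⟩
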